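/- arXiv:2510.03835 — 2 statements merged into one kernel-verified Lean document; each statement's English description precedes it below -/
import Mathlib

section
/- (Algebraic-decay Strain–Guo lemma.) Let m > 0, δ̄ > 0 and 𝔠 > 0, and let g : [0,∞) × ℝ³ → ℝ be smooth. Assume: (i) uniform weighted bound: sup_{t ≥ 0} ∫_{ℝ³} ⟨v⟩^{4m} g²(t,v) dv ≤ 𝔠; (ii) dissipation: for all 0 ≤ t₁ ≤ t₂, ∫_{ℝ³} g²(t₂,v) dv − ∫_{ℝ³} g²(t₁,v) dv + δ̄ ∫_{t₁}^{t₂} ∫_{ℝ³} ⟨v⟩^{−m} g²(τ,v) dv dτ ≤ 0 (in particular all displayed integrals are finite and t ↦ ∫ g²(t,v) dv is well defined). Then there is a constant C = C(m) > 0, independent of δ̄, 𝔠 and g, such that ∫_{ℝ³} g²(t,v) dv ≤ C 𝔠 (1 + δ̄ t)^{−3} for all t ≥ 0. -/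
open MeasureTheory Real

noncomputable section

/-- ℝ³ as a Euclidean space. -/
abbrev E3 := EuclideanSpace ℝ (Fin 3)

/-- Japanese bracket `⟨v⟩ = √(1 + |v|²)`. -/
def jap (v : E3) : ℝ := Real.sqrt (1 + ‖v‖ ^ 2)

lemma one_le_jap (v : E3) : 1 ≤ jap v := by
  unfold jap
  rw [Real.one_le_sqrt]
  nlinarith [sq_nonneg ‖v‖]

/-- Pointwise interpolation between the two weights. -/
lemma jap_interp (m : ℝ) (v : E3) (R : ℝ) (hR : 0 < R) :
    1 ≤ R * jap v ^ (-m) + (R ^ 4)⁻¹ * jap v ^ (4 * m) := by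
  have hj : 0 < jap v := lt_of_lt_of_le one_pos (one_le_jap v)
  have h4 : jap v ^ (4 * m) = (jap v ^ m) ^ 4 := by
    rw [mul_comm, Real.rpow_mul hj.le]
    norm_cast
  rw [h4, Real.rpow_neg hj.le]
  have hJ : 0 < jap v ^ m := Real.rpow_pos_of_pos hj m
  generalize jap v ^ m = J at hJ
  rcases le_total J R with h | h
  · have h1 : 1 ≤ R * J⁻¹ := by
      rw [← div_eq_mul_inv, le_div_iff₀ hJ]; linarith
    have h2 : 0 ≤ (R ^ 4)⁻¹ * J ^ 4 := by positivity
    linarith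
  · have h1 : 0 ≤ R * J⁻¹ := by positivity
    have h2 : 1 ≤ (R ^ 4)⁻¹ * J ^ 4 := by
      rw [mul_comm, ← div_eq_mul_inv, le_div_iff₀ (by positivity), one_mul]
      gcongr
    linarith

/-- Abstract decay argument. -/
lemma decay_core (y D : ℝ → ℝ) (δ c : ℝ) (hδ : 0 < δ) (hc : 0 < c)
    (hD0 : ∀ t, 0 ≤ D t)
    (hDi : ∀ t₁ t₂ : ℝ, 0 ≤ t₁ → t₁ ≤ t₂ → IntervalIntegrable D volume t₁ t₂)
    (hyc : ∀ t, 0 ≤ t → y t ≤ c)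
    (hint : ∀ t, 0 ≤ t → ∀ R, 0 < R → y t ≤ R * D t + (R ^ 4)⁻¹ * c)
    (hdis : ∀ t₁ t₂ : ℝ, 0 ≤ t₁ → t₁ ≤ t₂ → y t₂ - y t₁ + δ * ∫ τ in t₁..t₂, D τ ≤ 0)
    (n : ℕ) : ∀ t, 0 ≤ t → 1 + δ * t ≤ 2 ^ n → y t * (1 + δ * t) ^ 3 ≤ 2 ^ 19 * c := by
  have hanti : ∀ t₁ t₂ : ℝ, 0 ≤ t₁ → t₁ ≤ t₂ → y t₂ ≤ y t₁ := by
    intro a b ha hab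
    have h1 : 0 ≤ ∫ τ in a..b, D τ := intervalIntegral.integral_nonneg hab (fun u _ => hD0 u)
    have h2 := hdis a b ha hab
    have h3 := mul_nonneg hδ.le h1
    linarith
  have hsmall : ∀ t, 0 ≤ t → 1 + δ * t ≤ 2 → y t * (1 + δ * t) ^ 3 ≤ 2 ^ 19 * c := by
    intro t ht h
    have h0 : 0 ≤ δ * t := by positivity
    have h8 : (1 + δ * t) ^ 3 ≤ 2 ^ 3 := by gcongr
    calc y t * (1 + δ * t) ^ 3 ≤ c * (1 + δ * t) ^ 3 := by gcongr; exact hyc t ht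
      _ ≤ c * 2 ^ 3 := by gcongr
      _ ≤ 2 ^ 19 * c := by linarith
  induction n with
  | zero => intro t ht h; exact hsmall t ht (by norm_num at h ⊢; linarith)
  | succ n ih =>
    intro t ht h
    rcases le_total (1 + δ * t) 2 with h2 | h2
    · exact hsmall t ht h2
    obtain ⟨s, hs⟩ : ∃ s, s = 1 + δ * t := ⟨_, rfl⟩
    rw [← hs] at h h2 ⊢
    obtain ⟨a, ha⟩ : ∃ a, a = (s / 2 - 1) / δ := ⟨_, rfl⟩
    have ha' : 1 + δ * a = s / 2 := by rw [ha]; field_simp; ring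
    have ha0 : 0 ≤ a := by rw [ha]; apply div_nonneg <;> linarith
    have hlen : δ * (t - a) = s / 2 := by linarith
    have hat : a ≤ t := by
      have : 0 < δ * (t - a) := by linarith
      have := pos_of_mul_pos_right this hδ.le
      linarith
    have h1 := ih a ha0 (by rw [ha', pow_succ] at *; linarith)
    rw [ha'] at h1
    have hspos : 0 < s := by linarith
    have hlow : ∀ τ ∈ Set.Icc a t, (y t - (( s / 16) ^ 4)⁻¹ * c) / (s / 16) ≤ D τ := by
      intro τ hτ
      rw [div_le_iff₀ (by positivity)]
      have := hint τ (ha0.trans hτ.1) (s / 16) (by positivity)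
      have := hanti τ t (ha0.trans hτ.1) hτ.2
      linarith
    have hI : ∫ τ in a..t, (y t - (( s / 16) ^ 4)⁻¹ * c) / (s / 16) ≤ ∫ τ in a..t, D τ :=
      intervalIntegral.integral_mono_on hat (by simp) (hDi a t ha0 hat) hlow
    rw [intervalIntegral.integral_const, smul_eq_mul] at hI
    have hI2 := mul_le_mul_of_nonneg_left hI hδ.le
    rw [← mul_assoc, hlen] at hI2
    have hd := hdis a t ha0 hat
    have e : s / 2 * ((y t - ((s / 16) ^ 4)⁻¹ * c) / (s / 16)) = 8 * y t - 2 ^ 19 * c / s ^ 4 := by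
      field_simp; ring
    rw [e] at hI2
    have h9 : 9 * y t ≤ y a + 2 ^ 19 * c / s ^ 4 := by linarith
    have h10 := mul_le_mul_of_nonneg_right h9 (pow_nonneg hspos.le 3)
    have h11 : 2 ^ 19 * c / s ^ 4 * s ^ 3 ≤ 2 ^ 19 * c := by
      have : 2 ^ 19 * c / s ^ 4 * s ^ 3 = 2 ^ 19 * c / s := by field_simp
      rw [this]
      exact div_le_self (by positivity) (by linarith)
    nlinarith

/-- **Algebraic-decay Strain–Guo lemma.**  Let `m > 0`.  There is a constant `C = C(m) > 0`,
independent of `δ̄`, `𝔠` and `g`, such that for every `δ̄ > 0`, `𝔠 > 0`, and every smooth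
`g : [0,∞) × ℝ³ → ℝ` satisfying
(i) `sup_{t ≥ 0} ∫ ⟨v⟩^{4m} g²(t,v) dv ≤ 𝔠`, and
(ii) for all `0 ≤ t₁ ≤ t₂`,
`∫ g²(t₂) dv − ∫ g²(t₁) dv + δ̄ ∫_{t₁}^{t₂} ∫ ⟨v⟩^{−m} g² dv dτ ≤ 0`
(all displayed integrals being finite), we have
`∫ g²(t,v) dv ≤ C 𝔠 (1 + δ̄ t)^{−3}` for all `t ≥ 0`. -/
theorem strain_guo_algebraic_decay (m : ℝ) (hm : 0 < m) :
    ∃ C > 0, ∀ (δ 𝔠 : ℝ), 0 < δ → 0 < 𝔠 → ∀ g : ℝ → E3 → ℝ,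
      ContDiff ℝ (⊤ : ℕ∞) (fun p : ℝ × E3 => g p.1 p.2) →
      (∀ t, 0 ≤ t → Integrable fun v : E3 => (g t v) ^ 2) →
      (∀ t, 0 ≤ t → Integrable fun v : E3 => jap v ^ (4 * m) * (g t v) ^ 2) →
      (∀ t, 0 ≤ t → Integrable fun v : E3 => jap v ^ (-m) * (g t v) ^ 2) →
      (∀ t₁ t₂ : ℝ, 0 ≤ t₁ → t₁ ≤ t₂ →
        IntervalIntegrable (fun τ => ∫ v : E3, jap v ^ (-m) * (g τ v) ^ 2) volume t₁ t₂) →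
      (∀ t, 0 ≤ t → (∫ v : E3, jap v ^ (4 * m) * (g t v) ^ 2) ≤ 𝔠) →
      (∀ t₁ t₂ : ℝ, 0 ≤ t₁ → t₁ ≤ t₂ →
        (∫ v : E3, (g t₂ v) ^ 2) - (∫ v : E3, (g t₁ v) ^ 2)
          + δ * ∫ τ in t₁..t₂, ∫ v : E3, jap v ^ (-m) * (g τ v) ^ 2 ≤ 0) →
      ∀ t, 0 ≤ t → (∫ v : E3, (g t v) ^ 2) ≤ C * 𝔠 * (1 + δ * t) ^ (-(3:ℝ)) := by
  refine ⟨2 ^ 19, by positivity, ?_⟩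
  intro δ c hδ hc g _ hg h4 hm' hDi hbd hdis t ht
  have hj : ∀ v, 0 < jap v := fun v => lt_of_lt_of_le one_pos (one_le_jap v)
  have hs : 0 < 1 + δ * t := by positivity
  obtain ⟨n, hn⟩ := pow_unbounded_of_one_lt (1 + δ * t) (one_lt_two)
  have key := decay_core (fun t => ∫ v : E3, (g t v) ^ 2)
    (fun τ => ∫ v : E3, jap v ^ (-m) * (g τ v) ^ 2) δ c hδ hc
    (fun t => integral_nonneg fun v =>
      mul_nonneg (Real.rpow_nonneg (hj v).le _) (sq_nonneg _)) hDi ?_ ?_ hdis n t ht hn.le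
  · rw [Real.rpow_neg hs.le, ← div_eq_mul_inv, le_div_iff₀ (by positivity)]
    norm_cast at key ⊢
  · intro t ht
    refine le_trans (integral_mono (hg t ht) (h4 t ht) fun v => ?_) (hbd t ht)
    have := Real.one_le_rpow (one_le_jap v) (by positivity : 0 ≤ 4 * m)
    exact le_mul_of_one_le_left (sq_nonneg _) this
  · intro t ht R hR
    have h1 := integral_mono (hg t ht)
      (((hm' t ht).const_mul R).add ((h4 t ht).const_mul (R ^ 4)⁻¹)) (fun v => by
        have := mul_le_mul_of_nonneg_right (jap_interp m v R hR) (sq_nonneg (g t v))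
        simp only [Pi.add_apply]
        linarith)
    simp only [Pi.add_apply] at h1
    rw [integral_add ((hm' t ht).const_mul R) ((h4 t ht).const_mul (R ^ 4)⁻¹),
      integral_const_mul, integral_const_mul] at h1
    have h2 := mul_le_mul_of_nonneg_left (hbd t ht) (by positivity : 0 ≤ (R ^ 4)⁻¹)
    linarith
end
end

section
/- (Stretched-exponential-decay Strain–Guo lemma.) Let m > 0, q₀ > 0, δ₀ > 0, δ₁ > 0, 𝔠 > 0, T ∈ (0,∞], and let q̃ satisfy 0 < q̃ < q₀/2 and q̃ ≤ 1 + m. Let g, h : [0,T) × ℝ³ → ℝ be smooth and let R : [0,T) → [0,∞) be measurable. Assume: (i) sup_{0 ≤ t < T} ∫_{ℝ³} e^{q₀⟨v⟩} g²(t,v) dv ≤ 𝔠; (ii) for all 0 ≤ t₁ ≤ t₂ < T, ∫_{ℝ³} g²(t₂,v) dv − ∫_{ℝ³} g²(t₁,v) dv + δ₀ ∫_{t₁}^{t₂} ∫_{ℝ³} ⟨v⟩^{−m} g²(τ,v) dv dτ + δ₁ ∫_{t₁}^{t₂} ∫_{ℝ³} h²(τ,v) dv dτ ≤ ∫_{t₁}^{t₂}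 R(τ) dτ, with all displayed integrals finite and t ↦ ∫ h²(t,v) dv measurable; (iii) ∫₀^T e^{q̃ (δ₀ t)^{1/(1+m)}} R(t) dt ≤ 𝔠. Then there is a constant C = C(q₀, q̃, m) > 0, independent of δ₀, δ₁, T, 𝔠, g, h, such that sup_{0 ≤ t < T} e^{q̃ (δ₀ t)^{1/(1+m)}} ∫_{ℝ³} g²(t,v) dv + δ₁ ∫₀^T e^{q̃ (δ₀ t)^{1/(1+m)}} ∫_{ℝ³} h²(t,v) dv dt ≤ C 𝔠. -/
open MeasureTheory Real ENNReal

noncomputable section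

/-- The time interval `[0, T)` for `T ∈ (0, ∞]`. -/
def timeSet (T : ℝ≥0∞) : Set ℝ := {t : ℝ | 0 ≤ t ∧ ENNReal.ofReal t < T}

/-- Triangle Fubini / integration by parts. -/
lemma sg_ibp {w G : ℝ → ℝ} {t : ℝ} (hw : IntervalIntegrable w volume 0 t)
    (hG : IntervalIntegrable G volume 0 t) :
    ∫ x in (0:ℝ)..t, (∫ y in (0:ℝ)..x, w y) * G x = ∫ x in (0:ℝ)..t, w x * ∫ y in x..t, G y := by
  have hf := hw.absolutelyContinuousOnInterval_intervalIntegral (c := 0) (by simp)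
  have hg := hG.absolutelyContinuousOnInterval_intervalIntegral (c := t) (by simp)
  have key := hf.integral_mul_deriv_eq_deriv_mul hg
  have h1 : ∫ x in (0:ℝ)..t, (∫ y in (0:ℝ)..x, w y) * deriv (fun x => ∫ v in t..x, G v) x
      = ∫ x in (0:ℝ)..t, (∫ y in (0:ℝ)..x, w y) * G x := by
    apply intervalIntegral.integral_congr_ae
    filter_upwards [hG.ae_hasDerivAt_integral] with x hx hx'
    rw [(hx (Set.uIoc_subset_uIcc hx') t (by simp)).deriv]
  have h2 : ∫ x in (0:ℝ)..t, deriv (fun x => ∫ v in (0:ℝ)..x, w v) x * (∫ y in t..x, G y)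
      = - ∫ x in (0:ℝ)..t, w x * ∫ y in x..t, G y := by
    rw [← intervalIntegral.integral_neg]
    apply intervalIntegral.integral_congr_ae
    filter_upwards [hw.ae_hasDerivAt_integral] with x hx hx'
    rw [(hx (Set.uIoc_subset_uIcc hx') 0 (by simp)).deriv, intervalIntegral.integral_symm x t]
    ring
  rw [h1, h2] at key
  rw [key]
  simp

/-- Abstract weighted Gronwall-type inequality. -/
lemma sg_weighted {E D H R W w b : ℝ → ℝ} {t δ₀ δ₁ : ℝ} (ht : 0 ≤ t)
    (hD : IntervalIntegrable D volume 0 t) (hH : IntervalIntegrable H volume 0 t)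
    (hR : IntervalIntegrable R volume 0 t) (hw : IntervalIntegrable w volume 0 t)
    (hb : IntervalIntegrable b volume 0 t)
    (hW : ContinuousOn W (Set.Icc 0 t)) (hW0 : W 0 = 1)
    (hWw : ∀ x ∈ Set.Ioo 0 t, HasDerivAt W (w x) x)
    (hw0 : ∀ x ∈ Set.Ioo 0 t, 0 ≤ w x)
    (hE : ∀ x ∈ Set.Ioo 0 t, w x * E x ≤ W x * (δ₀ * D x) + b x)
    (hen : ∀ x ∈ Set.Icc 0 t, E t - E x + δ₀ * (∫ τ in x..t, D τ) + δ₁ * (∫ τ in x..t, H τ)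
      ≤ ∫ τ in x..t, R τ) :
    W t * E t + δ₁ * (∫ x in (0:ℝ)..t, W x * H x)
      ≤ E 0 + (∫ x in (0:ℝ)..t, W x * R x) + ∫ x in (0:ℝ)..t, b x := by
  have hWu : ContinuousOn W (Set.uIcc 0 t) := by rwa [Set.uIcc_of_le ht]
  have hWint : ∀ x ∈ Set.Icc 0 t, W x = 1 + ∫ y in (0:ℝ)..x, w y := by
    intro x hx
    rw [intervalIntegral.integral_eq_sub_of_hasDerivAt_of_le hx.1
      (hW.mono (Set.Icc_subset_Icc_right hx.2))
      (fun y hy => hWw y ⟨hy.1, hy.2.trans_le hx.2⟩)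
      (hw.mono_set (by rw [Set.uIcc_of_le ht, Set.uIcc_of_le hx.1]
                       exact Set.Icc_subset_Icc_right hx.2)), hW0]
    ring
  let G : ℝ → ℝ := fun x => δ₀ * D x + δ₁ * H x - R x
  have hG : IntervalIntegrable G volume 0 t := ((hD.const_mul δ₀).add (hH.const_mul δ₁)).sub hR
  have hsub : ∀ {f : ℝ → ℝ}, IntervalIntegrable f volume 0 t → ∀ x ∈ Set.Icc 0 t,
      IntervalIntegrable f volume x t := by
    intro f hf x hx
    exact hf.mono_set (by rw [Set.uIcc_of_le ht, Set.uIcc_of_le hx.2]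
                          exact Set.Icc_subset_Icc_left hx.1)
  have hGle : ∀ x ∈ Set.Icc 0 t, ∫ y in x..t, G y ≤ E x - E t := by
    intro x hx
    have := hen x hx
    have e : ∫ y in x..t, G y = δ₀ * (∫ τ in x..t, D τ) + δ₁ * (∫ τ in x..t, H τ)
        - ∫ τ in x..t, R τ := by
      rw [intervalIntegral.integral_sub
          (((hsub hD x hx).const_mul δ₀).add ((hsub hH x hx).const_mul δ₁)) (hsub hR x hx),
        intervalIntegral.integral_add ((hsub hD x hx).const_mul δ₀) ((hsub hH x hx).const_mul δ₁),
        intervalIntegral.integral_const_mul, intervalIntegral.integral_const_mul]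
    linarith
  have hf := hw.absolutelyContinuousOnInterval_intervalIntegral (c := 0) (by simp)
  have hg := hG.absolutelyContinuousOnInterval_intervalIntegral (c := t) (by simp)
  have hgc : ContinuousOn (fun x => ∫ y in x..t, G y) (Set.uIcc 0 t) := by
    refine hg.continuousOn.neg.congr fun x _ => ?_
    exact intervalIntegral.integral_symm t x
  have hWD := (hD.const_mul δ₀).continuousOn_mul hWu
  have hWH := hH.continuousOn_mul hWu
  have hWR := hR.continuousOn_mul hWu
  have e1 : ∫ x in (0:ℝ)..t, W x * G x = (∫ x in (0:ℝ)..t, G x)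
      + ∫ x in (0:ℝ)..t, w x * ∫ y in x..t, G y := by
    rw [← sg_ibp hw hG, ← intervalIntegral.integral_add hG (hG.continuousOn_mul hf.continuousOn)]
    apply intervalIntegral.integral_congr
    intro x hx
    rw [Set.uIcc_of_le ht] at hx
    simp only [hWint x hx]
    ring
  have e2 : ∫ x in (0:ℝ)..t, W x * G x = (∫ x in (0:ℝ)..t, W x * (δ₀ * D x))
      + δ₁ * (∫ x in (0:ℝ)..t, W x * H x) - ∫ x in (0:ℝ)..t, W x * R x := by
    rw [← intervalIntegral.integral_const_mul, ← intervalIntegral.integral_add hWD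
      (hWH.const_mul δ₁), ← intervalIntegral.integral_sub (hWD.add (hWH.const_mul δ₁)) hWR]
    apply intervalIntegral.integral_congr
    intro x _
    simp only [G]
    ring
  have e3 : ∫ x in (0:ℝ)..t, w x * ∫ y in x..t, G y
      ≤ ∫ x in (0:ℝ)..t, (W x * (δ₀ * D x) + b x - w x * E t) := by
    apply intervalIntegral.integral_mono_on_of_le_Ioo ht (hw.mul_continuousOn hgc)
      ((hWD.add hb).sub (hw.mul_const (E t)))
    intro x hx
    have h1 := mul_le_mul_of_nonneg_left (hGle x ⟨hx.1.le, hx.2.le⟩) (hw0 x hx)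
    have h2 := hE x hx
    linarith
  rw [intervalIntegral.integral_sub (hWD.add hb) (hw.mul_const (E t)),
    intervalIntegral.integral_add hWD hb, intervalIntegral.integral_mul_const] at e3
  have e4 := hGle 0 ⟨le_rfl, ht⟩
  have e5 := hWint t ⟨ht, le_rfl⟩
  have e6 : W t * E t = E t + (∫ y in (0:ℝ)..t, w y) * E t := by rw [e5]; ring
  linarith

lemma sg_jap_pos (v : E3) : 0 < jap v := by
  unfold jap; positivity

/-- Splitting velocity space at `⟨v⟩ = s`. -/
lemma sg_split {f : E3 → ℝ} {m q s : ℝ} (hm : 0 < m) (hq : 0 < q) (hs : 0 < s)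
    (hf0 : ∀ v, 0 ≤ f v) (h1 : Integrable f)
    (h2 : Integrable fun v => Real.exp (q * jap v) * f v)
    (h3 : Integrable fun v => jap v ^ (-m) * f v) :
    ∫ v, f v ≤ s ^ m * (∫ v, jap v ^ (-m) * f v)
      + Real.exp (-(q * s)) * ∫ v, Real.exp (q * jap v) * f v := by
  rw [← integral_const_mul, ← integral_const_mul,
    ← integral_add (h3.const_mul _) (h2.const_mul _)]
  apply integral_mono h1 ((h3.const_mul _).add (h2.const_mul _))
  intro v
  have hj := sg_jap_pos v
  have key : 1 ≤ s ^ m * jap v ^ (-m) + Real.exp (-(q * s)) * Real.exp (q * jap v) := by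
    rcases le_total (jap v) s with h | h
    · have : 1 ≤ s ^ m * jap v ^ (-m) := by
        rw [Real.rpow_neg hj.le, ← div_eq_mul_inv, one_le_div (by positivity)]
        exact Real.rpow_le_rpow hj.le h hm.le
      have : 0 ≤ Real.exp (-(q * s)) * Real.exp (q * jap v) := by positivity
      linarith
    · have : 1 ≤ Real.exp (-(q * s)) * Real.exp (q * jap v) := by
        rw [← Real.exp_add]
        apply Real.one_le_exp
        nlinarith
      have : 0 ≤ s ^ m * jap v ^ (-m) := by positivity
      linarith
  have := mul_le_mul_of_nonneg_right key (hf0 v)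
  simp only [Pi.add_apply]
  linarith

lemma sg_int_le {f : E3 → ℝ} {q : ℝ} (hq : 0 < q) 
    (hf0 : ∀ v, 0 ≤ f v) (h1 : Integrable f)
    (h2 : Integrable fun v => Real.exp (q * jap v) * f v) :
    ∫ v, f v ≤ ∫ v, Real.exp (q * jap v) * f v := by
  apply integral_mono h1 h2
  intro v
  have hj := sg_jap_pos v
  have : 1 ≤ Real.exp (q * jap v) := Real.one_le_exp (by positivity)
  have := mul_le_mul_of_nonneg_right this (hf0 v)
  simp only
  linarith

lemma sg_deriv {a δ₀ p x : ℝ} (hδ : 0 < δ₀) (hx : 0 < x) :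
    HasDerivAt (fun x => Real.exp (a * (δ₀ * x) ^ p))
      (Real.exp (a * (δ₀ * x) ^ p) * (a * (δ₀ * p * (δ₀ * x) ^ (p - 1)))) x := by
  have h1 : HasDerivAt (fun x => δ₀ * x) δ₀ x := by
    simpa using (hasDerivAt_id x).const_mul δ₀
  have h2 := h1.rpow_const (p := p) (Or.inl (by positivity : δ₀ * x ≠ 0))
  exact (h2.const_mul a).exp

lemma sg_cont {a δ₀ p : ℝ} (hp : 0 < p) :
    Continuous (fun x : ℝ => Real.exp (a * (δ₀ * x) ^ p)) := by
  have : Continuous (fun x : ℝ => (δ₀ * x) ^ p) :=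
    (continuous_const.mul continuous_id).rpow_const (fun _ => Or.inr hp.le)
  fun_prop

lemma sg_timeSet_mono {T : ℝ≥0∞} {t x : ℝ} (ht : t ∈ timeSet T) (hx : x ∈ Set.Icc 0 t) :
    x ∈ timeSet T :=
  ⟨hx.1, (ENNReal.ofReal_le_ofReal hx.2).trans_lt ht.2⟩

lemma sg_timeSet_iUnion (T : ℝ≥0∞) :
    timeSet T = ⋃ q : {q : ℚ // (q : ℝ) ∈ timeSet T}, Set.Icc (0:ℝ) (q.1 : ℝ) := by
  ext t
  simp only [Set.mem_iUnion]
  constructor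
  · intro ht
    obtain ⟨q, hq0, h1, h2⟩ := ENNReal.lt_iff_exists_rat_btwn.1 ht.2
    have hq : (q : ℝ) ∈ timeSet T := ⟨by exact_mod_cast hq0, h2⟩
    refine ⟨⟨q, hq⟩, ht.1, ?_⟩
    have : ENNReal.ofReal t < ENNReal.ofReal q := h1
    exact (ENNReal.ofReal_lt_ofReal_iff'.1 this).1.le
  · rintro ⟨q, hq⟩
    exact sg_timeSet_mono q.2 hq

/-- **Stretched-exponential-decay Strain–Guo lemma.**  Let `m, q₀ > 0` and
`0 < qt < q₀/2` with `qt ≤ 1 + m`.  There is a constant `C = C(q₀, qt, m) > 0`,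
independent of `δ₀, δ₁, T, 𝔠, g, h`, such that for every `T ∈ (0,∞]`,
`δ₀, δ₁, 𝔠 > 0`, smooth `g, h : [0,T) × ℝ³ → ℝ` and measurable `R : [0,T) → [0,∞)`
satisfying
(i) `sup_{0 ≤ t < T} ∫ e^{q₀⟨v⟩} g²(t,v) dv ≤ 𝔠`;
(ii) for all `0 ≤ t₁ ≤ t₂ < T`,
`∫ g²(t₂) − ∫ g²(t₁) + δ₀ ∫_{t₁}^{t₂}∫ ⟨v⟩^{−m} g² + δ₁ ∫_{t₁}^{t₂}∫ h² ≤ ∫_{t₁}^{t₂} R`,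
with all displayed integrals finite;
(iii) `∫₀^T e^{qt (δ₀ t)^{1/(1+m)}} R(t) dt ≤ 𝔠`,
one has
`sup_{0 ≤ t < T} e^{qt (δ₀ t)^{1/(1+m)}} ∫ g²(t) dv
  + δ₁ ∫₀^T e^{qt (δ₀ t)^{1/(1+m)}} ∫ h²(t) dv dt ≤ C 𝔠`. -/
theorem strain_guo_stretched_exponential_decay
    (m q₀ qt : ℝ) (hm : 0 < m) (hq₀ : 0 < q₀)
    (hqt0 : 0 < qt) (hqt1 : qt < q₀ / 2) (hqt2 : qt ≤ 1 + m) :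
    ∃ C > 0, ∀ T : ℝ≥0∞, 0 < T → ∀ (δ₀ δ₁ 𝔠 : ℝ), 0 < δ₀ → 0 < δ₁ → 0 < 𝔠 →
    ∀ (g h : ℝ → E3 → ℝ) (R : ℝ → ℝ),
      ContDiffOn ℝ (⊤ : ℕ∞) (fun p : ℝ × E3 => g p.1 p.2) (timeSet T ×ˢ Set.univ) →
      ContDiffOn ℝ (⊤ : ℕ∞) (fun p : ℝ × E3 => h p.1 p.2) (timeSet T ×ˢ Set.univ) →
      Measurable R → (∀ t, 0 ≤ R t) →
      (∀ t ∈ timeSet T, Integrable fun v : E3 => (g t v) ^ 2) →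
      (∀ t ∈ timeSet T, Integrable fun v : E3 => Real.exp (q₀ * jap v) * (g t v) ^ 2) →
      (∀ t ∈ timeSet T, Integrable fun v : E3 => jap v ^ (-m) * (g t v) ^ 2) →
      (∀ t ∈ timeSet T, Integrable fun v : E3 => (h t v) ^ 2) →
      (∀ t ∈ timeSet T, (∫ v : E3, Real.exp (q₀ * jap v) * (g t v) ^ 2) ≤ 𝔠) →
      (∀ t₁ t₂ : ℝ, t₁ ∈ timeSet T → t₂ ∈ timeSet T → t₁ ≤ t₂ →
        IntervalIntegrable (fun τ => ∫ v : E3, jap v ^ (-m) * (g τ v) ^ 2) volume t₁ t₂ ∧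
        IntervalIntegrable (fun τ => ∫ v : E3, (h τ v) ^ 2) volume t₁ t₂ ∧
        IntervalIntegrable R volume t₁ t₂) →
      (∀ t₁ t₂ : ℝ, t₁ ∈ timeSet T → t₂ ∈ timeSet T → t₁ ≤ t₂ →
        (∫ v : E3, (g t₂ v) ^ 2) - (∫ v : E3, (g t₁ v) ^ 2)
          + δ₀ * (∫ τ in t₁..t₂, ∫ v : E3, jap v ^ (-m) * (g τ v) ^ 2)
          + δ₁ * (∫ τ in t₁..t₂, ∫ v : E3, (h τ v) ^ 2)
          ≤ ∫ τ in t₁..t₂, R τ) →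
      IntegrableOn (fun t => Real.exp (qt * (δ₀ * t) ^ (1/(1+m))) * R t) (timeSet T) →
      (∫ t in timeSet T, Real.exp (qt * (δ₀ * t) ^ (1/(1+m))) * R t) ≤ 𝔠 →
      (∀ t ∈ timeSet T,
          Real.exp (qt * (δ₀ * t) ^ (1/(1+m))) * (∫ v : E3, (g t v) ^ 2) ≤ C * 𝔠) ∧
        ENNReal.ofReal δ₁ *
          (∫⁻ t in timeSet T,
            ENNReal.ofReal
              (Real.exp (qt * (δ₀ * t) ^ (1/(1+m))) * ∫ v : E3, (h t v) ^ 2))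
          ≤ ENNReal.ofReal (C * 𝔠) := by
  refine ⟨3, by norm_num, ?_⟩
  intro T hT δ₀ δ₁ 𝔠 hδ₀ hδ₁ h𝔠 g h R _ _ hRm hR0 hg1 hg2 hg3 hh1 hgc hint hen hRi hRc
  have hp : 0 < 1 / (1 + m) := by positivity
  have hqp : qt * (1 / (1 + m)) ≤ 1 := by
    rw [mul_one_div]; exact (div_le_one (by positivity)).2 hqt2
  have hpm : (1 / (1 + m)) * m + (1 / (1 + m) - 1) = 0 := by field_simp; ring
  set p := 1 / (1 + m) with hpdef
  have hzero : (0:ℝ) ∈ timeSet T := ⟨le_rfl, by simpa using hT⟩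
  have hmain : ∀ t ∈ timeSet T,
      Real.exp (qt * (δ₀ * t) ^ p) * (∫ v : E3, (g t v) ^ 2)
        + δ₁ * (∫ x in (0:ℝ)..t, Real.exp (qt * (δ₀ * x) ^ p) * ∫ v : E3, (h x v) ^ 2)
        ≤ 3 * 𝔠 := by
    intro t ht
    have ht0 : 0 ≤ t := ht.1
    obtain ⟨hD, hH, hR⟩ := hint 0 t hzero ht ht0
    set k := q₀ - qt with hk
    have hk0 : 0 < k := by linarith
    -- the weight derivative
    have hw0 : ∀ x ∈ Set.Ioo 0 t, 0 ≤ Real.exp (qt * (δ₀ * x) ^ p)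
        * (qt * (δ₀ * p * (δ₀ * x) ^ (p - 1))) := by
      intro x hx
      have := hx.1
      positivity
    have hwi : IntervalIntegrable (fun x => Real.exp (qt * (δ₀ * x) ^ p)
        * (qt * (δ₀ * p * (δ₀ * x) ^ (p - 1)))) volume 0 t := by
      apply intervalIntegral.intervalIntegrable_deriv_of_nonneg
        (g := fun x => Real.exp (qt * (δ₀ * x) ^ p)) (sg_cont hp).continuousOn
      · intro x hx
        rw [min_eq_left ht0, max_eq_right ht0] at hx
        exact sg_deriv hδ₀ hx.1
      · intro x hx
        rw [min_eq_left ht0, max_eq_right ht0] at hx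
        exact hw0 x hx
    -- the remainder
    let b : ℝ → ℝ := fun x => (-(𝔠 * qt / k)) * (Real.exp ((-k) * (δ₀ * x) ^ p)
        * ((-k) * (δ₀ * p * (δ₀ * x) ^ (p - 1))))
    have hbd : ∀ x ∈ Set.Ioo 0 t,
        HasDerivAt (fun x => (-(𝔠 * qt / k)) * Real.exp ((-k) * (δ₀ * x) ^ p)) (b x) x :=
      fun x hx => (sg_deriv hδ₀ hx.1).const_mul _
    have hbeq : ∀ x, b x = 𝔠 * qt * (Real.exp ((-k) * (δ₀ * x) ^ p)
        * (δ₀ * p * (δ₀ * x) ^ (p - 1))) := by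
      intro x
      simp only [b]
      field_simp
    have hbi : IntervalIntegrable b volume 0 t := by
      apply intervalIntegral.intervalIntegrable_deriv_of_nonneg
        (g := fun x => (-(𝔠 * qt / k)) * Real.exp ((-k) * (δ₀ * x) ^ p))
        ((sg_cont hp).const_mul _).continuousOn
      · intro x hx
        rw [min_eq_left ht0, max_eq_right ht0] at hx
        exact hbd x hx
      · intro x hx
        rw [min_eq_left ht0, max_eq_right ht0] at hx
        have := hx.1
        rw [hbeq]
        positivity
    have hbint : ∫ x in (0:ℝ)..t, b x ≤ 𝔠 := by
      rw [intervalIntegral.integral_eq_sub_of_hasDerivAt_of_le ht0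
        ((sg_cont hp).const_mul _).continuousOn hbd hbi]
      simp only [mul_zero, Real.zero_rpow hp.ne', Real.exp_zero]
      have h1 : 0 ≤ 𝔠 * qt / k * Real.exp ((-k) * (δ₀ * t) ^ p) := by positivity
      have h2 : 𝔠 * qt / k ≤ 𝔠 := by
        rw [div_le_iff₀ hk0]
        apply mul_le_mul_of_nonneg_left _ h𝔠.le
        linarith
      linarith
    have key := sg_weighted (E := fun t => ∫ v : E3, (g t v) ^ 2)
      (W := fun x => Real.exp (qt * (δ₀ * x) ^ p)) (b := b) (δ₀ := δ₀) (δ₁ := δ₁)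
      ht0 hD hH hR hwi hbi (sg_cont hp).continuousOn
      (by simp [Real.zero_rpow hp.ne']) (fun x hx => sg_deriv hδ₀ hx.1) hw0
      (by
        intro x hx
        have hxT := sg_timeSet_mono ht ⟨hx.1.le, hx.2.le⟩
        have hx0 : 0 < δ₀ * x := mul_pos hδ₀ hx.1
        have hs : 0 < (δ₀ * x) ^ p := by positivity
        have hsp := sg_split (f := fun v => (g x v) ^ 2) hm hq₀ hs (fun v => sq_nonneg _)
          (hg1 x hxT) (hg2 x hxT) (hg3 x hxT)
        have hc := hgc x hxT
        have hDn : 0 ≤ ∫ v : E3, jap v ^ (-m) * (g x v) ^ 2 :=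
          integral_nonneg fun v => by
            have := sg_jap_pos v
            positivity
        rw [hbeq]
        have hc' := mul_le_mul_of_nonneg_left hc (Real.exp_pos (-(q₀ * (δ₀ * x) ^ p))).le
        have hE := hsp.trans (add_le_add_right hc' _)
        have hwx := hw0 x hx
        refine (mul_le_mul_of_nonneg_left hE hwx).trans ?_
        have h1 : ((δ₀ * x) ^ p) ^ m * (δ₀ * x) ^ (p - 1) = 1 := by
          rw [← Real.rpow_mul hx0.le, ← Real.rpow_add hx0, hpm, Real.rpow_zero]
        have h2 : Real.exp (qt * (δ₀ * x) ^ p) * Real.exp (-(q₀ * (δ₀ * x) ^ p))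
            = Real.exp ((-k) * (δ₀ * x) ^ p) := by
          rw [← Real.exp_add]; congr 1; rw [hk]; ring
        rw [← h2]
        have h3 : 0 ≤ (1 - qt * p) * (Real.exp (qt * (δ₀ * x) ^ p) * (δ₀ *
            ∫ v : E3, jap v ^ (-m) * (g x v) ^ 2)) := by
          apply mul_nonneg (by linarith)
          positivity
        have h4 : Real.exp (qt * (δ₀ * x) ^ p) * (qt * (δ₀ * p * (δ₀ * x) ^ (p - 1)))
            * (((δ₀ * x) ^ p) ^ m * ∫ v : E3, jap v ^ (-m) * (g x v) ^ 2)
            = qt * p * (Real.exp (qt * (δ₀ * x) ^ p) * (δ₀ *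
            ∫ v : E3, jap v ^ (-m) * (g x v) ^ 2)) := by
          linear_combination (Real.exp (qt * (δ₀ * x) ^ p) * (qt * δ₀ * p)
            * ∫ v : E3, jap v ^ (-m) * (g x v) ^ 2) * h1
        rw [mul_add, h4]
        linarith)
      (fun x hx => hen x t (sg_timeSet_mono ht hx) ht hx.2)
    have hE0 : ∫ v : E3, (g 0 v) ^ 2 ≤ 𝔠 :=
      (sg_int_le hq₀ (fun v => sq_nonneg _) (hg1 0 hzero) (hg2 0 hzero)).trans (hgc 0 hzero)
    have hRt : ∫ x in (0:ℝ)..t, Real.exp (qt * (δ₀ * x) ^ p) * R x ≤ 𝔠 := by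
      refine le_trans ?_ hRc
      rw [intervalIntegral.integral_of_le ht0]
      apply setIntegral_mono_set hRi
      · exact Filter.Eventually.of_forall fun x => mul_nonneg (Real.exp_pos _).le (hR0 x)
      · exact (HasSubset.Subset.eventuallyLE fun x hx => sg_timeSet_mono ht ⟨hx.1.le, hx.2⟩)
    linarith
  have hHn : ∀ x, 0 ≤ Real.exp (qt * (δ₀ * x) ^ p) * ∫ v : E3, (h x v) ^ 2 := fun x =>
    mul_nonneg (Real.exp_pos _).le (integral_nonneg fun v => sq_nonneg _)
  refine ⟨fun t ht => ?_, ?_⟩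
  · have h1 := hmain t ht
    have h2 : 0 ≤ ∫ x in (0:ℝ)..t, Real.exp (qt * (δ₀ * x) ^ p) * ∫ v : E3, (h x v) ^ 2 :=
      intervalIntegral.integral_nonneg ht.1 fun x _ => hHn x
    have h3 := mul_nonneg hδ₁.le h2
    linarith
  · rw [sg_timeSet_iUnion, setLIntegral_iUnion_of_directed, ENNReal.mul_iSup]
    · apply iSup_le
      rintro ⟨q, hq⟩
      have hq0 : (0:ℝ) ≤ q := hq.1
      have hHi := (hint 0 q hzero hq hq0).2.1
      have hWH := hHi.continuousOn_mul (sg_cont (a := qt) (δ₀ := δ₀) hp).continuousOn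
      have h1 := hmain q hq
      have h2 : 0 ≤ Real.exp (qt * (δ₀ * (q:ℝ)) ^ p) * (∫ v : E3, (g q v) ^ 2) :=
        mul_nonneg (Real.exp_pos _).le (integral_nonneg fun v => sq_nonneg _)
      have hI : IntegrableOn (fun x => Real.exp (qt * (δ₀ * x) ^ p) * ∫ v : E3, (h x v) ^ 2)
          (Set.Icc 0 (q:ℝ)) := by
        rw [integrableOn_Icc_iff_integrableOn_Ioc]
        exact (intervalIntegrable_iff_integrableOn_Ioc_of_le hq0).1 hWH
      rw [← ofReal_integral_eq_lintegral_ofReal hI (Filter.Eventually.of_forall hHn),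
        ← ENNReal.ofReal_mul hδ₁.le]
      apply ENNReal.ofReal_le_ofReal
      rw [integral_Icc_eq_integral_Ioc, ← intervalIntegral.integral_of_le hq0]
      linarith
    · apply directed_of_isDirected_le
      intro a b hab
      apply Set.Icc_subset_Icc_right
      exact_mod_cast hab
end
end
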